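/- arXiv:1403.7829 — 3 statements merged into one kernel-verified Lean document; each statement's English description precedes it below -/
import Mathlib

section
/- Let C_0, …, C_n be real numbers and Tf(x) = min_{i=0,…,n}(C_i + i·x). Then the map x ↦ −x is a bijection from the set of zeros of Tf onto the set of slopes of the faces of the lower convex hull of the points (i, C_i), i = 0,…,n. In particular, the number of zeros of Tf equals the number of faces of this lower convex hull. Moreover, at each zero x, the decrease in slope of Tf at x (the left derivative of Tf at x minus its right derivative, which is the multiplicity of the zero) equals the horizontal (lattice) length of the corresponding face; consequently the number of zeros counted with multiplicity equals the total lattice length of the faces. -/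
open MeasureTheory Filter Set Topology

/-- The tropical polynomial `Tf(x) = min_{i=0,…,n} (c_i + i·x)`. -/
noncomputable def tropPoly {n : ℕ} (c : Fin (n + 1) → ℝ) (x : ℝ) : ℝ :=
  Finset.univ.inf' Finset.univ_nonempty fun i => c i + (i : ℕ) * x

/-- `x` is a zero of the tropical polynomial: the minimum defining `Tf(x)` is attained
by at least two distinct indices. -/
def IsTropZero {n : ℕ} (c : Fin (n + 1) → ℝ) (x : ℝ) : Prop :=
  ∃ i j : Fin (n + 1), i ≠ j ∧ c i + (i : ℕ) * x = tropPoly c x ∧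
    c j + (j : ℕ) * x = tropPoly c x

/-- The lower convex hull function of the points `p i`: the pointwise supremum of all
affine functions lying below all of the points.  On the interval
`[min first coordinate, max first coordinate]` this is the largest convex function `h`
with `h((p i).1) ≤ (p i).2` for all `i`. -/
noncomputable def lowerHull {n : ℕ} (p : Fin (n + 1) → ℝ × ℝ) (x : ℝ) : ℝ :=
  sSup {z : ℝ | ∃ a b : ℝ, (∀ i, a * (p i).1 + b ≤ (p i).2) ∧ z = a * x + b}

/-- `s` is the slope of a face of the lower convex hull of the points `p i`
(with first coordinates increasing from `(p 0).1` to `(p (Fin.last n)).1`):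
the hull function is affine with slope `s` on some nondegenerate subinterval. -/
def IsFaceSlope {n : ℕ} (p : Fin (n + 1) → ℝ × ℝ) (s : ℝ) : Prop :=
  ∃ u v : ℝ, u < v ∧ Set.Icc u v ⊆ Set.Icc ((p 0).1) ((p (Fin.last n)).1) ∧
    ∀ x ∈ Set.Icc u v, lowerHull p x = lowerHull p u + s * (x - u)

/-- The horizontal (lattice) length of the face of slope `s` of the lower convex hull:
the supremum of the lengths of intervals on which the hull function is affine with
slope `s`. -/
noncomputable def faceLength {n : ℕ} (p : Fin (n + 1) → ℝ × ℝ) (s : ℝ) : ℝ :=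
  sSup {d : ℝ | ∃ u v : ℝ, d = v - u ∧ u < v ∧
    Set.Icc u v ⊆ Set.Icc ((p 0).1) ((p (Fin.last n)).1) ∧
    ∀ x ∈ Set.Icc u v, lowerHull p x = lowerHull p u + s * (x - u)}

/-- The points `(i, C_i)` attached to the coefficients of a tropical polynomial. -/
abbrev coeffPoints {n : ℕ} (c : Fin (n + 1) → ℝ) : Fin (n + 1) → ℝ × ℝ :=
  fun i => ((i : ℕ), c i)

section TropPoly

variable {n : ℕ} (c : Fin (n + 1) → ℝ)

theorem tropPoly_le (i : Fin (n + 1)) (x : ℝ) : tropPoly c x ≤ c i + (i : ℕ) * x :=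
  Finset.inf'_le _ (Finset.mem_univ i)

theorem le_tropPoly_iff {b x : ℝ} : b ≤ tropPoly c x ↔ ∀ i, b ≤ c i + (i : ℕ) * x := by
  simp [tropPoly]

theorem exists_eq_tropPoly (x : ℝ) : ∃ i : Fin (n + 1), c i + (i : ℕ) * x = tropPoly c x := by
  obtain ⟨i, -, hi⟩ := Finset.exists_mem_eq_inf' Finset.univ_nonempty
    fun i : Fin (n + 1) => c i + (i : ℕ) * x
  exact ⟨i, hi.symm⟩

/-- `l` and `r` are the least and the greatest index attaining the minimum `Tf(x)`. -/
structure IsArgminRange (x : ℝ) (l r : Fin (n + 1)) : Prop where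
  left_eq : c l + (l : ℕ) * x = tropPoly c x
  right_eq : c r + (r : ℕ) * x = tropPoly c x
  left_le : ∀ i : Fin (n + 1), c i + (i : ℕ) * x = tropPoly c x → l ≤ i
  le_right : ∀ i : Fin (n + 1), c i + (i : ℕ) * x = tropPoly c x → i ≤ r

theorem exists_isArgminRange (x : ℝ) : ∃ l r, IsArgminRange c x l r := by
  classical
  let S := Finset.univ.filter fun i : Fin (n + 1) => c i + (i : ℕ) * x = tropPoly c x
  have hS : S.Nonempty := by
    obtain ⟨i, hi⟩ := exists_eq_tropPoly c x
    exact ⟨i, by simp [S, hi]⟩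
  exact ⟨S.min' hS, S.max' hS, (Finset.mem_filter.1 (S.min'_mem hS)).2,
    (Finset.mem_filter.1 (S.max'_mem hS)).2,
    fun i hi => S.min'_le i (by simp [S, hi]), fun i hi => S.le_max' i (by simp [S, hi])⟩

variable {c} {x : ℝ} {l r : Fin (n + 1)}

namespace IsArgminRange

theorem left_le_right (h : IsArgminRange c x l r) : l ≤ r := h.left_le r h.right_eq

theorem isTropZero_iff (h : IsArgminRange c x l r) : IsTropZero c x ↔ l < r := by
  constructor
  · rintro ⟨i, j, hij, hi, hj⟩
    by_contra hlr
    have hrl := not_lt.1 hlr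
    exact hij (le_antisymm ((h.le_right i hi).trans (hrl.trans (h.left_le j hj)))
      ((h.le_right j hj).trans (hrl.trans (h.left_le i hi))))
  · exact fun hlr => ⟨l, r, hlr.ne, h.left_eq, h.right_eq⟩

theorem eventually_lt (hk : c l + (l : ℕ) * x = tropPoly c x) (i : Fin (n + 1))
    (hi : c i + (i : ℕ) * x ≠ tropPoly c x) :
    ∀ᶠ y in 𝓝 x, c l + (l : ℕ) * y < c i + (i : ℕ) * y := by
  have hlt : c l + (l : ℕ) * x < c i + (i : ℕ) * x :=
    hk ▸ lt_of_le_of_ne (tropPoly_le c i x) hi.symm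
  exact ContinuousAt.eventually_lt (by fun_prop) (by fun_prop) hlt

theorem eventuallyEq_right (h : IsArgminRange c x l r) :
    tropPoly c =ᶠ[𝓝[>] x] fun y => c l + (l : ℕ) * y := by
  have key : ∀ᶠ y in 𝓝[>] x, ∀ i : Fin (n + 1), c l + (l : ℕ) * y ≤ c i + (i : ℕ) * y := by
    refine eventually_all.2 fun i => ?_
    by_cases hi : c i + (i : ℕ) * x = tropPoly c x
    · filter_upwards [self_mem_nhdsWithin] with y hy
      have hli : ((l : ℕ) : ℝ) ≤ (i : ℕ) := by exact_mod_cast h.left_le i hi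
      nlinarith [h.left_eq, mul_nonneg (sub_nonneg.2 hli) (sub_nonneg.2 (le_of_lt hy))]
    · filter_upwards [nhdsWithin_le_nhds (eventually_lt h.left_eq i hi)] with y hy using hy.le
  filter_upwards [key] with y hy
  exact le_antisymm (tropPoly_le c l y) ((le_tropPoly_iff c).2 hy)

theorem eventuallyEq_left (h : IsArgminRange c x l r) :
    tropPoly c =ᶠ[𝓝[<] x] fun y => c r + (r : ℕ) * y := by
  have key : ∀ᶠ y in 𝓝[<] x, ∀ i : Fin (n + 1), c r + (r : ℕ) * y ≤ c i + (i : ℕ) * y := by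
    refine eventually_all.2 fun i => ?_
    by_cases hi : c i + (i : ℕ) * x = tropPoly c x
    · filter_upwards [self_mem_nhdsWithin] with y hy
      have hir : ((i : ℕ) : ℝ) ≤ (r : ℕ) := by exact_mod_cast h.le_right i hi
      nlinarith [h.right_eq, mul_nonneg (sub_nonneg.2 hir) (sub_nonneg.2 (le_of_lt hy))]
    · filter_upwards [nhdsWithin_le_nhds (eventually_lt h.right_eq i hi)] with y hy using hy.le
  filter_upwards [key] with y hy
  exact le_antisymm (tropPoly_le c r y) ((le_tropPoly_iff c).2 hy)

theorem derivWithin_Ioi (h : IsArgminRange c x l r) :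
    derivWithin (tropPoly c) (Ioi x) x = (l : ℕ) := by
  have hd : HasDerivAt (fun y => c l + (l : ℕ) * y) ((l : ℕ) : ℝ) x := by
    simpa using ((hasDerivAt_id x).const_mul ((l : ℕ) : ℝ)).const_add (c l)
  exact (hd.hasDerivWithinAt.congr_of_eventuallyEq h.eventuallyEq_right
    h.left_eq.symm).derivWithin (uniqueDiffWithinAt_Ioi x)

theorem derivWithin_Iio (h : IsArgminRange c x l r) :
    derivWithin (tropPoly c) (Iio x) x = (r : ℕ) := by
  have hd : HasDerivAt (fun y => c r + (r : ℕ) * y) ((r : ℕ) : ℝ) x := by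
    simpa using ((hasDerivAt_id x).const_mul ((r : ℕ) : ℝ)).const_add (c r)
  exact (hd.hasDerivWithinAt.congr_of_eventuallyEq h.eventuallyEq_left
    h.right_eq.symm).derivWithin (uniqueDiffWithinAt_Iio x)

end IsArgminRange

end TropPoly

section LowerHull

variable {n : ℕ} {c : Fin (n + 1) → ℝ}

theorem affine_le_of_mem_Icc {a b p q y z t : ℝ} {m k : ℝ} (hp : a * p + b ≤ y)
    (hq : a * q + b ≤ z) (hy : y = m * p + k) (hz : z = m * q + k) (ht : t ∈ Icc p q) :
    a * t + b ≤ m * t + k := by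
  obtain ⟨h1, h2⟩ := ht
  rcases le_total a m with h | h
  · nlinarith [mul_nonneg (sub_nonneg.2 h) (sub_nonneg.2 h1)]
  · nlinarith [mul_nonneg (sub_nonneg.2 h) (sub_nonneg.2 h2)]

theorem bddAbove_lowerHull {t : ℝ} (ht : t ∈ Icc (0 : ℝ) n) :
    BddAbove {z : ℝ | ∃ a b : ℝ,
      (∀ i, a * (coeffPoints c i).1 + b ≤ (coeffPoints c i).2) ∧ z = a * t + b} := by
  refine ⟨max (c 0) (c (Fin.last n)), ?_⟩
  rintro z ⟨a, b, hab, rfl⟩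
  have h0 := hab 0
  have hn := hab (Fin.last n)
  simp only [Fin.val_zero, Nat.cast_zero, Fin.val_last] at h0 hn
  simpa using affine_le_of_mem_Icc (m := 0) (k := max (c 0) (c (Fin.last n)))
    (h0.trans (le_max_left _ (c (Fin.last n)))) (hn.trans (le_max_right (c 0) _))
    (by simp) (by simp) ht

theorem affine_le_lowerHull {a b t : ℝ} (hab : ∀ i : Fin (n + 1), a * (i : ℕ) + b ≤ c i)
    (ht : t ∈ Icc (0 : ℝ) n) : a * t + b ≤ lowerHull (coeffPoints c) t :=
  le_csSup (bddAbove_lowerHull ht) ⟨a, b, hab, rfl⟩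

theorem affine_tropPoly_le (x : ℝ) (i : Fin (n + 1)) : -x * (i : ℕ) + tropPoly c x ≤ c i := by
  linarith [tropPoly_le c i x]

theorem lowerHull_le {t z : ℝ}
    (h : ∀ a b : ℝ, (∀ i : Fin (n + 1), a * (i : ℕ) + b ≤ c i) → a * t + b ≤ z) :
    lowerHull (coeffPoints c) t ≤ z := by
  refine csSup_le ⟨_, -0, tropPoly c 0, fun i => affine_tropPoly_le 0 i, rfl⟩ ?_
  rintro _ ⟨a, b, hab, rfl⟩
  exact h a b hab

theorem natCast_mem_Icc (i : Fin (n + 1)) : ((i : ℕ) : ℝ) ∈ Icc (0 : ℝ) n :=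
  ⟨Nat.cast_nonneg _, by exact_mod_cast Fin.is_le i⟩

theorem convexOn_lowerHull : ConvexOn ℝ (Icc (0 : ℝ) n) (lowerHull (coeffPoints c)) := by
  refine ⟨convex_Icc _ _, fun s hs t ht p q hp hq hpq => lowerHull_le fun a b hab => ?_⟩
  have h1 := mul_le_mul_of_nonneg_left (affine_le_lowerHull hab hs) hp
  have h2 := mul_le_mul_of_nonneg_left (affine_le_lowerHull hab ht) hq
  simp only [smul_eq_mul]
  have hb : b = p * b + q * b := by rw [← add_mul, hpq, one_mul]
  linarith

/-- A convex function lies above the extension of any of its affine pieces. -/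
theorem ConvexOn.affine_le_of_affine_on_Icc {S : Set ℝ} {f : ℝ → ℝ} (hf : ConvexOn ℝ S f)
    {u v s t : ℝ} (huv : u < v) (hS : Icc u v ⊆ S)
    (h : ∀ y ∈ Icc u v, f y = f u + s * (y - u)) (ht : t ∈ S) : f u + s * (t - u) ≤ f t := by
  have hu := hS (left_mem_Icc.2 huv.le)
  have hv := hS (right_mem_Icc.2 huv.le)
  have hfv := h v (right_mem_Icc.2 huv.le)
  have hslope : (f v - f u) / (v - u) = s := by
    rw [hfv, add_sub_cancel_left, mul_div_cancel_right₀ _ (sub_pos.2 huv).ne']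
  rcases lt_or_ge t u with htu | htu
  · have := hf.slope_mono_adjacent ht hv htu huv
    rw [hslope, div_le_iff₀ (sub_pos.2 htu)] at this
    linarith
  rcases le_or_gt t v with htv | htv
  · exact (h t ⟨htu, htv⟩).ge
  · have := hf.slope_mono_adjacent hu ht huv htv
    rw [hslope, le_div_iff₀ (sub_pos.2 htv)] at this
    linarith

variable {x : ℝ} {l r : Fin (n + 1)}

namespace IsArgminRange

theorem lowerHull_eq_iff (h : IsArgminRange c x l r) {t : ℝ} (ht : t ∈ Icc (0 : ℝ) n) :
    lowerHull (coeffPoints c) t = -x * t + tropPoly c x ↔ t ∈ Icc ((l : ℕ) : ℝ) (r : ℕ) := by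
  constructor
  · intro heq
    by_contra hmem
    rcases lt_or_ge t ((l : ℕ) : ℝ) with htl | htl
    · obtain ⟨y, hy, hxy⟩ := (h.eventuallyEq_right.and self_mem_nhdsWithin).exists
      have hle := affine_le_lowerHull (affine_tropPoly_le (c := c) y) ht
      rw [heq, hy] at hle
      nlinarith [h.left_eq, mul_pos (sub_pos.2 htl) (sub_pos.2 (mem_Ioi.1 hxy))]
    · have hrt : ((r : ℕ) : ℝ) < t := not_le.1 fun hrt => hmem ⟨htl, hrt⟩
      obtain ⟨y, hy, hxy⟩ := (h.eventuallyEq_left.and self_mem_nhdsWithin).exists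
      have hle := affine_le_lowerHull (affine_tropPoly_le (c := c) y) ht
      rw [heq, hy] at hle
      nlinarith [h.right_eq, mul_pos (sub_pos.2 hrt) (sub_pos.2 (mem_Iio.1 hxy))]
  · intro hmem
    refine le_antisymm (lowerHull_le fun a b hab => ?_)
      (affine_le_lowerHull (affine_tropPoly_le x) ht)
    exact affine_le_of_mem_Icc (hab l) (hab r) (by linarith [h.left_eq])
      (by linarith [h.right_eq]) hmem

/-- The hull is affine of slope `-x` exactly on the subintervals of the interval spanned by the
indices attaining the minimum `Tf(x)`. -/
theorem affine_on_Icc_iff (h : IsArgminRange c x l r) {u v : ℝ} (huv : u < v) :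
    (Icc u v ⊆ Icc ((coeffPoints c 0).1) ((coeffPoints c (Fin.last n)).1) ∧
      ∀ y ∈ Icc u v, lowerHull (coeffPoints c) y
        = lowerHull (coeffPoints c) u + -x * (y - u)) ↔
    ((l : ℕ) : ℝ) ≤ u ∧ v ≤ (r : ℕ) := by
  simp only [Fin.val_zero, Nat.cast_zero, Fin.val_last]
  constructor
  · rintro ⟨hsub, haff⟩
    have hu := left_mem_Icc.2 huv.le
    have hv := right_mem_Icc.2 huv.le
    have hle : lowerHull (coeffPoints c) u + x * u ≤ tropPoly c x := by
      refine (le_tropPoly_iff c).2 fun i => ?_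
      have h1 := convexOn_lowerHull.affine_le_of_affine_on_Icc huv hsub haff (natCast_mem_Icc i)
      have h2 : lowerHull (coeffPoints c) (i : ℕ) ≤ c i := lowerHull_le fun a b hab => hab i
      linarith
    have hge := affine_le_lowerHull (affine_tropPoly_le (c := c) x) (hsub hu)
    refine ⟨((h.lowerHull_eq_iff (hsub hu)).1 (by linarith)).1,
      ((h.lowerHull_eq_iff (hsub hv)).1 ?_).2⟩
    linarith [haff v hv]
  · rintro ⟨hl, hr⟩
    have hsub : Icc u v ⊆ Icc (0 : ℝ) n :=
      Icc_subset_Icc ((natCast_mem_Icc l).1.trans hl) (hr.trans (natCast_mem_Icc r).2)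
    have heq : ∀ y ∈ Icc u v, lowerHull (coeffPoints c) y = -x * y + tropPoly c x :=
      fun y hy => (h.lowerHull_eq_iff (hsub hy)).2 (Icc_subset_Icc hl hr hy)
    refine ⟨hsub, fun y hy => ?_⟩
    rw [heq y hy, heq u (left_mem_Icc.2 huv.le)]
    ring

theorem isFaceSlope_iff (h : IsArgminRange c x l r) :
    IsFaceSlope (coeffPoints c) (-x) ↔ l < r := by
  constructor
  · rintro ⟨u, v, huv, haff⟩
    obtain ⟨hl, hr⟩ := (h.affine_on_Icc_iff huv).1 haff
    exact_mod_cast (hl.trans_lt huv).trans_le hr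
  · intro hlr
    have hlr' : ((l : ℕ) : ℝ) < (r : ℕ) := by exact_mod_cast hlr
    exact ⟨_, _, hlr', (h.affine_on_Icc_iff hlr').2 ⟨le_rfl, le_rfl⟩⟩

theorem faceLength_eq (h : IsArgminRange c x l r) (hlr : l < r) :
    faceLength (coeffPoints c) (-x) = (r : ℕ) - (l : ℕ) := by
  have hlr' : ((l : ℕ) : ℝ) < (r : ℕ) := by exact_mod_cast hlr
  refine IsGreatest.csSup_eq
    ⟨⟨_, _, rfl, hlr', (h.affine_on_Icc_iff hlr').2 ⟨le_rfl, le_rfl⟩⟩, ?_⟩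
  rintro _ ⟨u, v, rfl, huv, haff⟩
  obtain ⟨hl, hr⟩ := (h.affine_on_Icc_iff huv).1 haff
  linarith

end IsArgminRange

theorem isFaceSlope_neg_iff : IsFaceSlope (coeffPoints c) (-x) ↔ IsTropZero c x := by
  obtain ⟨l, r, h⟩ := exists_isArgminRange c x
  rw [h.isFaceSlope_iff, h.isTropZero_iff]

theorem IsTropZero.derivWithin_sub_eq_faceLength (hx : IsTropZero c x) :
    derivWithin (tropPoly c) (Iio x) x - derivWithin (tropPoly c) (Ioi x) x
      = faceLength (coeffPoints c) (-x) := by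
  obtain ⟨l, r, h⟩ := exists_isArgminRange c x
  rw [h.derivWithin_Iio, h.derivWithin_Ioi, h.faceLength_eq (h.isTropZero_iff.1 hx)]

theorem bijOn_neg_isTropZero :
    BijOn (fun x => -x) {x : ℝ | IsTropZero c x} {s : ℝ | IsFaceSlope (coeffPoints c) s} := by
  refine ⟨fun x hx => isFaceSlope_neg_iff.2 hx, neg_injective.injOn, fun s hs => ?_⟩
  refine ⟨-s, isFaceSlope_neg_iff.1 ?_, neg_neg s⟩
  rwa [neg_neg]

end LowerHull

/-- **Zeros of a tropical polynomial and faces of the lower convex hull.**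
The map `x ↦ −x` is a bijection from the set of zeros of `Tf` onto the set of slopes
of the faces of the lower convex hull of the points `(i, C_i)`; in particular the
number of zeros equals the number of faces.  Moreover the decrease in slope of `Tf`
at a zero `x` (left derivative minus right derivative, i.e. the multiplicity) equals
the horizontal length of the corresponding face, and consequently the number of zeros
counted with multiplicity equals the total lattice length of the faces. -/
theorem tropical_zeros_eq_lower_hull_faces (n : ℕ) (c : Fin (n + 1) → ℝ) :
    Set.BijOn (fun x => -x) {x : ℝ | IsTropZero c x}
      {s : ℝ | IsFaceSlope (fun i => ((i : ℕ) , c i)) s} ∧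
    Set.ncard {x : ℝ | IsTropZero c x}
      = Set.ncard {s : ℝ | IsFaceSlope (fun i => ((i : ℕ), c i)) s} ∧
    (∀ x : ℝ, IsTropZero c x →
      derivWithin (tropPoly c) (Set.Iio x) x - derivWithin (tropPoly c) (Set.Ioi x) x
        = faceLength (fun i => ((i : ℕ), c i)) (-x)) ∧
    (∑ᶠ x ∈ {x : ℝ | IsTropZero c x},
        (derivWithin (tropPoly c) (Set.Iio x) x - derivWithin (tropPoly c) (Set.Ioi x) x))
      = ∑ᶠ s ∈ {s : ℝ | IsFaceSlope (fun i => ((i : ℕ), c i)) s},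
          faceLength (fun i => ((i : ℕ), c i)) s := by
  have hbij := bijOn_neg_isTropZero (c := c)
  refine ⟨hbij, ?_, fun x hx => hx.derivWithin_sub_eq_faceLength,
    finsum_mem_eq_of_bijOn _ hbij fun x hx => hx.derivWithin_sub_eq_faceLength⟩
  exact hbij.injOn.ncard_image.symm.trans (congrArg ncard hbij.image_eq)
end

section
/- Consider the Markov chain on integer compositions defined as follows (the 'Beta(2,1) Chinese restaurant process'): the state after customer 1 is the composition (1); given that the state after n customers is a composition (x_1, …, x_m) of n, customer n+1 is appended to part i ∈ {1,…,m} with probability ((x_i + 1)/(n − s_i + 2)) · ∏_{j<i} (1 − (x_j + 1)/(n − s_j + 2)), where s_j = x_1 + ⋯ + x_{j−1} (s_1 = 0), and starts a new part of size 1 with the remaining probability. Then for every n ≥ 1 and every composition (x_1, …, x_m) of n, the probability that the state after n customers equals (x_1, …, x_m) is ∏_{i=1}^m ( x_i / binom(n − s_i + 1, 2) ), where s_i = x_1 + ⋯ + x_{i−1}. -/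
/-- In the Beta(2,1) Chinese restaurant process, given the current composition `xs`
(of `n = xs.sum`), the probability that the next customer joins the part with
(0-based) index `i`:
`((x_i + 1)/(n − s_i + 2)) · ∏_{j<i} (1 − (x_j + 1)/(n − s_j + 2))`,
where `s_j = x_1 + ⋯ + x_{j-1}` is the sum of the parts before part `j`. -/
noncomputable def crpJoinProb (xs : List ℕ) (i : ℕ) : ℝ :=
  ((xs.getD i 0 + 1 : ℝ) / ((xs.sum : ℝ) - ((xs.take i).sum : ℝ) + 2)) *
    ∏ j ∈ Finset.range i,
      (1 - (xs.getD j 0 + 1 : ℝ) / ((xs.sum : ℝ) - ((xs.take j).sum : ℝ) + 2))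

/-- `crpProb n ys` is the probability that the state of the Beta(2,1) Chinese
restaurant process after `n` customers is the composition `ys`.  The state after
`0` customers is the empty composition; customer `n+1` either increments an existing
part `i` (with probability `crpJoinProb`) or starts a new part of size `1` with the
remaining probability.  (In particular the state after customer `1` is `(1)` with
probability one.)  The recursion below sums over the possible predecessor states. -/
noncomputable def crpProb : ℕ → List ℕ → ℝ
  | 0, ys => if ys = [] then 1 else 0
  | n + 1, ys =>
      (∑ i ∈ Finset.range ys.length,
        if 2 ≤ ys.getD i 0 then
          crpProb n (ys.set i (ys.getD i 0 - 1)) * crpJoinProb (ys.set i (ys.getD i 0 - 1)) i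
        else 0)
      + (if ys.getLast? = some 1 then
          crpProb n ys.dropLast *
            (1 - ∑ i ∈ Finset.range ys.dropLast.length, crpJoinProb ys.dropLast i)
        else 0)

/-- The hull partition law `∏ x_i / binom(n − s_i + 1, 2)`, defined by recursion on the
composition. -/
noncomputable def hullLaw : List ℕ → ℝ
  | [] => 1
  | x :: t => (x : ℝ) / (Nat.choose (x + t.sum + 1) 2 : ℝ) * hullLaw t

theorem prod_eq_hullLaw (xs : List ℕ) :
    ∏ i ∈ Finset.range xs.length,
      (xs.getD i 0 : ℝ) / (Nat.choose (xs.sum - (xs.take i).sum + 1) 2 : ℝ) = hullLaw xs := by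
  induction xs with
  | nil => simp [hullLaw]
  | cons x t ih =>
    rw [List.length_cons, Finset.prod_range_succ', hullLaw, ← ih, mul_comm]
    simp [Nat.add_sub_add_left]

theorem crpJoinProb_cons_zero (x : ℕ) (t : List ℕ) :
    crpJoinProb (x :: t) 0 = (x + 1 : ℝ) / ((x : ℝ) + (t.sum : ℝ) + 2) := by
  simp [crpJoinProb]

theorem crpJoinProb_cons_succ (x : ℕ) (t : List ℕ) (i : ℕ) :
    crpJoinProb (x :: t) (i + 1)
      = (1 - (x + 1 : ℝ) / ((x : ℝ) + (t.sum : ℝ) + 2)) * crpJoinProb t i := by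
  rw [crpJoinProb, crpJoinProb, Finset.prod_range_succ']
  simp only [List.getD_cons_succ, List.getD_cons_zero, List.take_succ_cons, List.take_zero,
    List.sum_cons, List.sum_nil, Nat.cast_add, Nat.cast_zero, sub_zero, add_sub_add_left_eq_sub]
  ring

/-- The probability that the next customer starts a new part. -/
noncomputable def crpNewProb (xs : List ℕ) : ℝ :=
  1 - ∑ i ∈ Finset.range xs.length, crpJoinProb xs i

theorem crpNewProb_cons (x : ℕ) (t : List ℕ) :
    crpNewProb (x :: t)
      = (1 - (x + 1 : ℝ) / ((x : ℝ) + (t.sum : ℝ) + 2)) * crpNewProb t := by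
  rw [crpNewProb, crpNewProb, List.length_cons, Finset.sum_range_succ', crpJoinProb_cons_zero]
  simp only [crpJoinProb_cons_succ, ← Finset.mul_sum]
  ring

/-- The law of the state after one more customer, when the current state has law `p`. -/
noncomputable def crpStep (p : List ℕ → ℝ) (ys : List ℕ) : ℝ :=
  (∑ i ∈ Finset.range ys.length,
    if 2 ≤ ys.getD i 0 then
      p (ys.set i (ys.getD i 0 - 1)) * crpJoinProb (ys.set i (ys.getD i 0 - 1)) i
    else 0)
  + (if ys.getLast? = some 1 then p ys.dropLast * crpNewProb ys.dropLast else 0)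

theorem sum_set_getD_sub_one {ys : List ℕ} {i : ℕ} (h : 2 ≤ ys.getD i 0) :
    (ys.set i (ys.getD i 0 - 1)).sum + 1 = ys.sum := by
  induction ys generalizing i with
  | nil => simp at h
  | cons y t ih =>
    cases i with
    | zero => simp at h ⊢; omega
    | succ i =>
      have := ih (i := i) (by simpa using h)
      simp only [List.getD_cons_succ, List.set_cons_succ, List.sum_cons]
      omega

theorem sum_dropLast_add_one {ys : List ℕ} (h : ys.getLast? = some 1) :
    ys.dropLast.sum + 1 = ys.sum := by
  obtain ⟨l, rfl⟩ := List.getLast?_eq_some_iff.mp h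
  simp

theorem hullLaw_cons_mul (y S : ℕ) {u : List ℕ} (hu : u.sum + 1 = S) (q : ℝ) :
    hullLaw (y :: u) * ((1 - (y + 1 : ℝ) / ((y : ℝ) + (u.sum : ℝ) + 2)) * q)
      = (y : ℝ) / (Nat.choose (y + S) 2 : ℝ) * ((S : ℝ) / (y + S + 1)) * (hullLaw u * q) := by
  rw [hullLaw, add_assoc y, hu]
  obtain ⟨m, hm⟩ : ∃ m, u.sum = m := ⟨_, rfl⟩
  obtain rfl : m + 1 = S := hm ▸ hu
  rw [hm]
  have h : 1 - (y + 1 : ℝ) / ((y : ℝ) + (m : ℝ) + 2)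
      = ((m + 1 : ℕ) : ℝ) / (y + (m + 1 : ℕ) + 1) := by
    push_cast
    have : (y : ℝ) + (m + 1) + 1 = y + m + 2 := by ring
    rw [this]
    field_simp
    ring
  rw [h]
  ring

theorem crpStep_hullLaw_cons_cons (y z : ℕ) (t : List ℕ) :
    crpStep hullLaw (y :: z :: t)
      = (if 2 ≤ y then hullLaw ((y - 1) :: z :: t) * crpJoinProb ((y - 1) :: z :: t) 0 else 0)
        + (y : ℝ) / (Nat.choose (y + (z :: t).sum) 2 : ℝ)
          * (((z :: t).sum : ℝ) / (y + (z :: t).sum + 1)) * crpStep hullLaw (z :: t) := by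
  rw [crpStep, crpStep, List.length_cons, Finset.sum_range_succ', mul_add, Finset.mul_sum,
    List.getLast?_cons_cons, List.dropLast_cons_cons, add_comm (Finset.sum _ _), add_assoc]
  congr 1
  congr 1
  · refine Finset.sum_congr rfl fun i _ => ?_
    rw [List.getD_cons_succ, List.set_cons_succ]
    split_ifs with h
    · rw [crpJoinProb_cons_succ, hullLaw_cons_mul _ _ (sum_set_getD_sub_one h)]
    · simp
  · split_ifs with h
    · rw [crpNewProb_cons, hullLaw_cons_mul _ _ (sum_dropLast_add_one h)]
    · simp

theorem crpStep_hullLaw {ys : List ℕ} (hne : ys ≠ []) (hpos : ∀ y ∈ ys, 0 < y) :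
    crpStep hullLaw ys = hullLaw ys := by
  induction ys with
  | nil => exact absurd rfl hne
  | cons y t ih =>
    have hy : 0 < y := hpos y (by simp)
    obtain ⟨k, rfl⟩ : ∃ k, y = k + 1 := ⟨y - 1, by omega⟩
    have hfirst : (if 2 ≤ k + 1 then hullLaw (k :: t) * crpJoinProb (k :: t) 0 else 0)
        = (k : ℝ) / (Nat.choose (k + 1 + t.sum) 2 : ℝ) * ((k + 1 : ℝ) / (k + t.sum + 2))
          * hullLaw t := by
      split_ifs with h
      · rw [hullLaw, crpJoinProb_cons_zero, add_right_comm]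
        ring
      · obtain rfl : k = 0 := by omega
        simp
    cases t with
    | nil =>
      rcases Nat.eq_zero_or_pos k with rfl | hk
      · simp [crpStep, crpNewProb, hullLaw]
      · have hstep : crpStep hullLaw [k + 1]
            = if 2 ≤ k + 1 then hullLaw [k] * crpJoinProb [k] 0 else 0 := by
          simp [crpStep, hk.ne']
        rw [hstep, hfirst]
        simp only [hullLaw, List.sum_nil, Nat.add_zero, Nat.cast_choose_two]
        push_cast
        have e : (k : ℝ) + 1 - 1 = k := by ring
        have e' : (k : ℝ) + 1 + 1 - 1 = k + 1 := by ring
        rw [e, e']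
        field_simp
        ring
    | cons z t =>
      have hz : 0 < z := hpos z (by simp)
      have hS : 0 < (z :: t).sum := by simp; omega
      rw [crpStep_hullLaw_cons_cons, Nat.add_sub_cancel, hfirst,
        ih (by simp) fun y hy => hpos y (List.mem_cons_of_mem _ hy), hullLaw.eq_2 (k + 1)]
      generalize (z :: t).sum = S at *
      generalize hullLaw (z :: t) = F
      have hS' : (0 : ℝ) < S := by exact_mod_cast hS
      have hk : (k : ℝ) + S ≠ 0 := by positivity
      rw [Nat.cast_choose_two, Nat.cast_choose_two]
      push_cast
      have e : (k : ℝ) + 1 + S - 1 = k + S := by ring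
      have e' : (k : ℝ) + 1 + S + 1 - 1 = k + 1 + S := by ring
      rw [e, e']
      field_simp
      ring

theorem crpProb_eq_hullLaw (n : ℕ) (xs : List ℕ) (hpos : ∀ y ∈ xs, 0 < y)
    (hsum : xs.sum = n) : crpProb n xs = hullLaw xs := by
  induction n generalizing xs with
  | zero =>
    cases xs with
    | nil => simp [crpProb, hullLaw]
    | cons x t =>
      have := hpos x (by simp)
      simp at hsum
      omega
  | succ n ih =>
    have hne : xs ≠ [] := by rintro rfl; simp at hsum
    rw [← crpStep_hullLaw hne hpos, crpProb, crpStep]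
    congr 1
    · refine Finset.sum_congr rfl fun i _ => ?_
      split_ifs with h
      · rw [ih]
        · intro y hy
          rcases List.mem_or_eq_of_mem_set hy with hy | rfl
          · exact hpos y hy
          · omega
        · have := sum_set_getD_sub_one h
          omega
      · rfl
    · split_ifs with h
      · rw [ih, crpNewProb]
        · exact fun y hy => hpos y (List.mem_of_mem_dropLast hy)
        · have := sum_dropLast_add_one h
          omega
      · rfl

/-- **The Beta(2,1) Chinese restaurant process generates the hull partition law.**
For every `n ≥ 1` and every composition `(x_1, …, x_m)` of `n`, the probability that
the state after `n` customers equals `(x_1, …, x_m)` is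
`∏_{i=1}^m x_i / binom(n − s_i + 1, 2)` where `s_i = x_1 + ⋯ + x_{i−1}`. -/
theorem crpProb_eq (n : ℕ) (hn : 1 ≤ n) (xs : List ℕ)
    (hpos : ∀ y ∈ xs, 0 < y) (hsum : xs.sum = n) :
    crpProb n xs
      = ∏ i ∈ Finset.range xs.length,
          (xs.getD i 0 : ℝ) / (Nat.choose (n - (xs.take i).sum + 1) 2 : ℝ) := by
  subst hsum
  rw [prod_eq_hullLaw]
  exact crpProb_eq_hullLaw _ xs hpos rfl
end

section
/- Let F be a continuous probability distribution function with support (0,∞) such that F(y) = C·y^a + o(y^a) as y → 0+ for some constants C, a > 0, and let G be the measure on [0,∞) with G([0,x]) = −log(1 − F(x)). For s > 0, define I_s(b) = ((1−b)·G([0,sb]) + ∫_0^b G([0,st]) dt) / ∫_0^1 G([0,st]) dt for b ∈ [0,1]. Then for every s > 0, I_s is the cumulative distribution function of a probability distribution on [0,1], and as s → 0+, I_s converges weakly to the Beta(a,2) distribution, whose cumulative distribution function is I_0(b) = (a+1)·b^a − a·b^{a+1}; moreover sup_{b∈[0,1]} |I_s(b) − I_0(b)| → 0 as s → 0+. -/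
open MeasureTheory ProbabilityTheory Filter Set Topology

/-- `G([0,x]) = −log(1 − F(x))`, the intensity function associated with the
distribution function `F`. -/
noncomputable def Gfun (F : ℝ → ℝ) (x : ℝ) : ℝ := -Real.log (1 - F x)

/-- The distribution function
`I_s(b) = ((1−b)·G([0,sb]) + ∫_0^b G([0,st]) dt) / ∫_0^1 G([0,st]) dt`. -/
noncomputable def Icdf (F : ℝ → ℝ) (s b : ℝ) : ℝ :=
  ((1 - b) * Gfun F (s * b) + ∫ t in (0 : ℝ)..b, Gfun F (s * t)) /
    ∫ t in (0 : ℝ)..1, Gfun F (s * t)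

/-- The Beta(a,2) distribution: the measure on `(0,1)` with density
`a(a+1)·b^{a−1}(1−b)`. -/
noncomputable def betaA2 (a : ℝ) : Measure ℝ :=
  volume.withDensity (Set.indicator (Set.Ioo 0 1)
    fun b => ENNReal.ofReal (a * (a + 1) * b ^ (a - 1) * (1 - b)))

/-- `b ↦ (1 - b) g(b) + ∫₀ᵇ g`, the unnormalised distribution function built from `g`. -/
noncomputable def unnormCdf (g : ℝ → ℝ) (b : ℝ) : ℝ := (1 - b) * g b + ∫ t in (0 : ℝ)..b, g t

lemma continuous_unnormCdf {g : ℝ → ℝ} (hg : Continuous g) : Continuous (unnormCdf g) := by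
  unfold unnormCdf
  exact ((continuous_const.sub continuous_id).mul hg).add
    (intervalIntegral.continuous_primitive (fun _ _ => hg.intervalIntegrable _ _) 0)

lemma monotoneOn_unnormCdf {g : ℝ → ℝ} (hg : Continuous g) (hm : Monotone g) :
    MonotoneOn (unnormCdf g) (Icc 0 1) := by
  intro b _ c hc hbc
  have hsplit := intervalIntegral.integral_add_adjacent_intervals
    (hg.intervalIntegrable (μ := volume) 0 b) (hg.intervalIntegrable (μ := volume) b c)
  have hle : (c - b) * g b ≤ ∫ t in b..c, g t := by
    have := intervalIntegral.integral_mono_on hbc (intervalIntegrable_const (μ := volume) (c := g b))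
      (hg.intervalIntegrable (μ := volume) b c) (fun x hx => hm hx.1)
    simpa using this
  unfold unnormCdf
  nlinarith [mul_nonneg (sub_nonneg.2 hc.2) (sub_nonneg.2 (hm hbc))]

/-- A continuous function that increases from `0` to `1` on `[0,1]` is the distribution function
of a probability measure. -/
lemma exists_isProbabilityMeasure_Iic_eq {f : ℝ → ℝ} (hf : Continuous f)
    (hm : MonotoneOn f (Icc 0 1)) (h0 : f 0 = 0) (h1 : f 1 = 1) :
    ∃ μ : Measure ℝ, IsProbabilityMeasure μ ∧
      ∀ b ∈ Icc (0 : ℝ) 1, (μ (Iic b)).toReal = f b := by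
  have hmem : ∀ x : ℝ, max 0 (min x 1) ∈ Icc (0 : ℝ) 1 := fun x =>
    ⟨le_max_left _ _, max_le zero_le_one (min_le_right _ _)⟩
  let S : StieltjesFunction ℝ :=
    { toFun := fun x => f (max 0 (min x 1))
      mono' := fun x y hxy => hm (hmem x) (hmem y) (by gcongr)
      right_continuous' := fun x => by
        have : Continuous fun x : ℝ => f (max 0 (min x 1)) := by fun_prop
        exact this.continuousAt.continuousWithinAt }
  have hS : ∀ x, S x = f (max 0 (min x 1)) := fun _ => rfl
  have hbot : Tendsto S atBot (𝓝 0) := by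
    refine tendsto_const_nhds.congr' ?_
    filter_upwards [eventually_le_atBot (0 : ℝ)] with x hx
    rw [hS, min_eq_left (hx.trans zero_le_one), max_eq_left hx, h0]
  have htop : Tendsto S atTop (𝓝 1) := by
    refine tendsto_const_nhds.congr' ?_
    filter_upwards [eventually_ge_atTop (1 : ℝ)] with x hx
    rw [hS, min_eq_right hx, max_eq_right zero_le_one, h1]
  refine ⟨S.measure, S.isProbabilityMeasure hbot htop, fun b hb => ?_⟩
  have hSb : S b = f b := by rw [hS, min_eq_left hb.2, max_eq_right hb.1]
  rw [S.measure_Iic hbot, sub_zero, hSb, ENNReal.toReal_ofReal]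
  exact h0 ▸ hm ⟨le_rfl, zero_le_one⟩ hb hb.1

lemma integral_betaA2_density {a : ℝ} (ha : 0 < a) (b : ℝ) :
    IntervalIntegrable (fun x : ℝ => a * (a + 1) * x ^ (a - 1) * (1 - x)) volume 0 b ∧
      (0 ≤ b → ∫ x in (0 : ℝ)..b, a * (a + 1) * x ^ (a - 1) * (1 - x) =
        (a + 1) * b ^ a - a * b ^ (a + 1)) := by
  have i1 : IntervalIntegrable (fun x : ℝ => x ^ (a - 1)) volume 0 b :=
    intervalIntegral.intervalIntegrable_rpow' (by linarith)
  refine ⟨(i1.const_mul _).mul_continuousOn (by fun_prop), fun hb => ?_⟩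
  have i2 : IntervalIntegrable (fun x : ℝ => x ^ a) volume 0 b :=
    intervalIntegral.intervalIntegrable_rpow' (by linarith)
  have hcongr : ∫ x in (0 : ℝ)..b, a * (a + 1) * x ^ (a - 1) * (1 - x) =
      ∫ x in (0 : ℝ)..b, (a * (a + 1) * x ^ (a - 1) - a * (a + 1) * x ^ a) := by
    refine intervalIntegral.integral_congr_ae (Eventually.of_forall fun x hx => ?_)
    rw [uIoc_of_le hb] at hx
    have : x ^ a = x ^ (a - 1) * x := by
      rw [← Real.rpow_add_one hx.1.ne', sub_add_cancel]
    rw [this]; ring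
  rw [hcongr, intervalIntegral.integral_sub (i1.const_mul _) (i2.const_mul _),
    intervalIntegral.integral_const_mul, intervalIntegral.integral_const_mul,
    integral_rpow (Or.inl (by linarith)), integral_rpow (Or.inl (by linarith)),
    sub_add_cancel, Real.zero_rpow ha.ne', Real.zero_rpow (by positivity)]
  field_simp
  ring

lemma betaA2_Iic {a : ℝ} (ha : 0 < a) {b : ℝ} (hb : b ∈ Icc (0 : ℝ) 1) :
    (betaA2 a (Iic b)).toReal = (a + 1) * b ^ a - a * b ^ (a + 1) := by
  obtain ⟨hint, hval⟩ := integral_betaA2_density ha b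
  rw [intervalIntegrable_iff_integrableOn_Ioo_of_le hb.1] at hint
  rw [← hval hb.1, intervalIntegral.integral_of_le hb.1, integral_Ioc_eq_integral_Ioo, betaA2,
    withDensity_apply _ measurableSet_Iic, setLIntegral_indicator measurableSet_Ioo]
  have hset : (Ioo 0 1 ∩ Iic b : Set ℝ) =ᵐ[volume] Ioo 0 b := by
    have hsub : (Ioo 0 1 ∩ Iic b : Set ℝ) =ᵐ[volume] (Ioo 0 1 ∩ Iio b : Set ℝ) :=
      (ae_eq_refl _).inter Iio_ae_eq_Iic.symm
    rwa [Ioo_inter_Iio, min_eq_right hb.2] at hsub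
  have hnn : 0 ≤ᵐ[volume.restrict (Ioo 0 b)]
      fun x : ℝ => a * (a + 1) * x ^ (a - 1) * (1 - x) := by
    filter_upwards [ae_restrict_mem measurableSet_Ioo] with x hx
    have h1 : 0 ≤ 1 - x := by linarith [hx.2, hb.2]
    have h2 := Real.rpow_nonneg hx.1.le (a - 1)
    simp only [Pi.zero_apply]
    positivity
  rw [setLIntegral_congr hset, integral_eq_lintegral_of_nonneg_ae hnn hint.aestronglyMeasurable]

/-- If `F(y) ~ C y^a` to first order at `0⁺`, so is `-log (1 - F(y))`. -/
lemma Gfun_sub_isLittleO {F : ℝ → ℝ} {C a : ℝ} (hF0 : Tendsto F (𝓝[>] 0) (𝓝 0))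
    (hFa : (fun y => F y - C * y ^ a) =o[𝓝[>] (0 : ℝ)] fun y => y ^ a) :
    (fun y => Gfun F y - C * y ^ a) =o[𝓝[>] (0 : ℝ)] fun y => y ^ a := by
  have hlog : (fun x : ℝ => -Real.log (1 - x) - x) =o[𝓝 0] fun x => x := by
    have hd : HasDerivAt (fun x : ℝ => -Real.log (1 - x)) 1 0 := by
      have := (((hasDerivAt_id (0 : ℝ)).const_sub 1).log (by norm_num)).fun_neg
      simpa using this
    simpa using hd.isLittleO
  have hO : F =O[𝓝[>] 0] fun y : ℝ => y ^ a := by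
    have := hFa.isBigO.add (Asymptotics.isBigO_const_mul_self C (fun y : ℝ => y ^ a) (𝓝[>] 0))
    simpa using this
  have := ((hlog.comp_tendsto hF0).trans_isBigO hO).add hFa
  refine this.congr_left fun y => ?_
  simp [Gfun]

/-- Uniform closeness of `g` to `C t^a` on `[0,1]` passes to `unnormCdf`. -/
lemma abs_unnormCdf_sub_le {g : ℝ → ℝ} (hg : Continuous g) {C a ε : ℝ} (ha : 0 < a)
    (h : ∀ t ∈ Icc (0 : ℝ) 1, |g t - C * t ^ a| ≤ ε) {b : ℝ} (hb : b ∈ Icc (0 : ℝ) 1) :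
    |unnormCdf g b - C / (a + 1) * ((a + 1) * b ^ a - a * b ^ (a + 1))| ≤ ε := by
  have hpow : IntervalIntegrable (fun t : ℝ => C * t ^ a) volume 0 b :=
    (intervalIntegral.intervalIntegrable_rpow' (by linarith)).const_mul _
  have hint : |∫ t in (0 : ℝ)..b, (g t - C * t ^ a)| ≤ ε * b := by
    have := intervalIntegral.norm_integral_le_of_norm_le_const (a := 0) (b := b) (C := ε)
      (f := fun t => g t - C * t ^ a) fun t ht => by
        rw [uIoc_of_le hb.1] at ht
        exact h t ⟨ht.1.le, ht.2.trans hb.2⟩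
    simpa [abs_of_nonneg hb.1] using this
  rw [intervalIntegral.integral_sub (hg.intervalIntegrable _ _) hpow,
    intervalIntegral.integral_const_mul, integral_rpow (Or.inl (by linarith)),
    Real.zero_rpow (by positivity), sub_zero] at hint
  have hsucc : b ^ (a + 1) = b ^ a * b := by
    rw [Real.rpow_add_one' hb.1 (by positivity)]
  have heq : unnormCdf g b - C / (a + 1) * ((a + 1) * b ^ a - a * b ^ (a + 1)) =
      (1 - b) * (g b - C * b ^ a) +
        ((∫ t in (0 : ℝ)..b, g t) - C * (b ^ (a + 1) / (a + 1))) := by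
    rw [unnormCdf, hsucc]
    field_simp
    ring
  have h1 : |(1 - b) * (g b - C * b ^ a)| ≤ (1 - b) * ε := by
    rw [abs_mul, abs_of_nonneg (sub_nonneg.2 hb.2)]
    exact mul_le_mul_of_nonneg_left (h b hb) (sub_nonneg.2 hb.2)
  rw [heq]
  linarith [abs_add_le ((1 - b) * (g b - C * b ^ a))
    ((∫ t in (0 : ℝ)..b, g t) - C * (b ^ (a + 1) / (a + 1)))]

lemma unnormCdf_const_mul (c : ℝ) (g : ℝ → ℝ) (b : ℝ) :
    unnormCdf (fun t => c * g t) b = c * unnormCdf g b := by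
  simp only [unnormCdf, intervalIntegral.integral_const_mul]
  ring

lemma Icdf_eq_div (F : ℝ → ℝ) (s b : ℝ) :
    Icdf F s b = unnormCdf (fun t => Gfun F (s * t)) b / unnormCdf (fun t => Gfun F (s * t)) 1 := by
  simp [Icdf, unnormCdf]

lemma continuous_Gfun {F : ℝ → ℝ} (hF : Continuous F) (hlt : ∀ y, F y < 1) :
    Continuous (Gfun F) :=
  ((continuous_const.sub hF).log fun y => (sub_pos.2 (hlt y)).ne').neg

lemma monotone_Gfun {F : ℝ → ℝ} (hF : Monotone F) (hlt : ∀ y, F y < 1) :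
    Monotone (Gfun F) := fun _ y hxy =>
  neg_le_neg (Real.log_le_log (sub_pos.2 (hlt y)) (sub_le_sub_left (hF hxy) 1))

lemma Gfun_pos {F : ℝ → ℝ} {y : ℝ} (hpos : 0 < F y) (hlt : F y < 1) : 0 < Gfun F y :=
  neg_pos.2 (Real.log_neg (sub_pos.2 hlt) (sub_lt_self 1 hpos))

lemma tendstoUniformlyOn_Icdf {F : ℝ → ℝ} {C a : ℝ} (hC : 0 < C) (ha : 0 < a)
    (hG : Continuous (Gfun F)) (hG0 : Gfun F 0 = 0)
    (hGa : (fun y => Gfun F y - C * y ^ a) =o[𝓝[>] (0 : ℝ)] fun y => y ^ a) :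
    TendstoUniformlyOn (fun s b => Icdf F s b)
      (fun b => (a + 1) * b ^ a - a * b ^ (a + 1)) (𝓝[>] (0 : ℝ)) (Icc (0 : ℝ) 1) := by
  rw [Metric.tendstoUniformlyOn_iff]
  intro ε hε
  set D : ℝ := C / (a + 1) with hD
  have hDpos : 0 < D := by positivity
  obtain ⟨η, hη, hηD, hηε⟩ : ∃ η > 0, η ≤ D / 2 ∧ η * (2 * a + 2) < ε * (D / 2) := by
    refine ⟨min (D / 2) (ε * D / (8 * (a + 1))), by positivity, min_le_left _ _, ?_⟩
    calc _ ≤ ε * D / (8 * (a + 1)) * (2 * a + 2) := by gcongr; exact min_le_right _ _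
      _ = ε * D / 4 := by field_simp; ring
      _ < ε * (D / 2) := by nlinarith [mul_pos hε hDpos]
  obtain ⟨δ, hδ, hbound⟩ := (mem_nhdsGT_iff_exists_Ioc_subset (a := (0 : ℝ))).1 (hGa.def hη)
  filter_upwards [Ioc_mem_nhdsGT (show (0 : ℝ) < δ from hδ)] with s hs b hb
  have hspos : 0 < s ^ a := Real.rpow_pos_of_pos hs.1 a
  set g : ℝ → ℝ := fun t => (s ^ a)⁻¹ * Gfun F (s * t) with hg
  have hgc : Continuous g := by fun_prop
  have hgη : ∀ t ∈ Icc (0 : ℝ) 1, |g t - C * t ^ a| ≤ η := by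
    intro t ht
    rcases ht.1.eq_or_lt with rfl | htpos
    · simp [hg, hG0, Real.zero_rpow ha.ne', hη.le]
    · have hst : s * t ∈ Ioc 0 δ :=
        ⟨mul_pos hs.1 htpos, (mul_le_of_le_one_right hs.1.le ht.2).trans hs.2⟩
      have hb' : |Gfun F (s * t) - C * (s * t) ^ a| ≤ η * |(s * t) ^ a| := hbound hst
      rw [Real.mul_rpow hs.1.le ht.1, abs_of_nonneg (a := s ^ a * t ^ a) (by positivity)] at hb'
      have heq : g t - C * t ^ a = (s ^ a)⁻¹ * (Gfun F (s * t) - C * (s ^ a * t ^ a)) := by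
        rw [hg]; field_simp
      rw [heq, abs_mul, abs_of_pos (inv_pos.2 hspos)]
      calc _ ≤ (s ^ a)⁻¹ * (η * (s ^ a * t ^ a)) := by gcongr
        _ = η * t ^ a := by field_simp
        _ ≤ η := mul_le_of_le_one_right hη.le (Real.rpow_le_one ht.1 ht.2 ha.le)
  have hI : Icdf F s b = unnormCdf g b / unnormCdf g 1 := by
    rw [Icdf_eq_div, hg, unnormCdf_const_mul, unnormCdf_const_mul,
      mul_div_mul_left _ _ (inv_ne_zero hspos.ne')]
  have hN := abs_unnormCdf_sub_le hgc ha hgη hb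
  have hM : |unnormCdf g 1 - D| ≤ η := by
    simpa using abs_unnormCdf_sub_le hgc ha hgη (b := 1) ⟨zero_le_one, le_rfl⟩
  have hMD : D / 2 ≤ unnormCdf g 1 := by linarith [(abs_le.1 hM).1]
  have hMpos : 0 < unnormCdf g 1 := by linarith
  set I := (a + 1) * b ^ a - a * b ^ (a + 1) with hIdef
  have hIabs : |I| ≤ 2 * a + 1 := by
    have p0 := Real.rpow_nonneg hb.1 a
    have p1 := Real.rpow_le_one hb.1 hb.2 ha.le
    have q0 := Real.rpow_nonneg hb.1 (a + 1)
    have q1 := Real.rpow_le_one hb.1 hb.2 (by positivity : 0 ≤ a + 1)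
    rw [abs_le]
    constructor <;> nlinarith
  rw [Real.dist_eq, hI]
  have heq : I - unnormCdf g b / unnormCdf g 1 =
      (I * (unnormCdf g 1 - D) - (unnormCdf g b - D * I)) / unnormCdf g 1 := by
    field_simp
    ring
  rw [heq, abs_div, abs_of_pos hMpos, div_lt_iff₀ hMpos]
  calc _ ≤ |I * (unnormCdf g 1 - D)| + |unnormCdf g b - D * I| := abs_sub _ _
    _ ≤ (2 * a + 1) * η + η := by
        rw [abs_mul]
        gcongr
    _ < ε * (D / 2) := by linarith
    _ ≤ ε * unnormCdf g 1 := by gcongr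

/-- **The jump distributions `I_s` and their Beta(a,2) limit.**
If `F` is a continuous distribution function supported on `(0,∞)` with
`F(y) = C·y^a + o(y^a)` as `y → 0⁺`, then for every `s > 0` the function `I_s` is the
cumulative distribution function of a probability distribution on `[0,1]`; the
cumulative distribution function of the Beta(a,2) distribution is
`I_0(b) = (a+1)·b^a − a·b^{a+1}` on `[0,1]`; and `I_s → I_0` uniformly on `[0,1]`
as `s → 0⁺` (in particular `I_s` converges weakly to Beta(a,2)). -/
theorem Icdf_tendsto_beta
    (F : ℝ → ℝ) (Cc a : ℝ) (hCc : 0 < Cc) (ha : 0 < a)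
    (hFcont : Continuous F) (hFmono : Monotone F)
    (hF0 : ∀ y ≤ (0 : ℝ), F y = 0) (hFpos : ∀ y > (0 : ℝ), 0 < F y)
    (hFlt1 : ∀ y, F y < 1) (hFtop : Tendsto F atTop (𝓝 1))
    (hFa : (fun y => F y - Cc * y ^ a) =o[𝓝[>] (0 : ℝ)] fun y => y ^ a) :
    (∀ s > (0 : ℝ), ∃ μ : Measure ℝ, IsProbabilityMeasure μ ∧
      ∀ b ∈ Set.Icc (0 : ℝ) 1, (μ (Set.Iic b)).toReal = Icdf F s b) ∧
    (∀ b ∈ Set.Icc (0 : ℝ) 1,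
      ((betaA2 a) (Set.Iic b)).toReal = (a + 1) * b ^ a - a * b ^ (a + 1)) ∧
    TendstoUniformlyOn (fun s b => Icdf F s b)
      (fun b => (a + 1) * b ^ a - a * b ^ (a + 1)) (𝓝[>] (0 : ℝ))
      (Set.Icc (0 : ℝ) 1) := by
  have hG := continuous_Gfun hFcont hFlt1
  have hG0 : Gfun F 0 = 0 := by simp [Gfun, hF0 0 le_rfl]
  refine ⟨fun s hs => ?_, fun b hb => betaA2_Iic ha hb, tendstoUniformlyOn_Icdf hCc ha hG hG0 ?_⟩
  · have hgc : Continuous fun t => Gfun F (s * t) := by fun_prop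
    have hgm : Monotone fun t => Gfun F (s * t) :=
      (monotone_Gfun hFmono hFlt1).comp fun _ _ h => mul_le_mul_of_nonneg_left h hs.le
    have hpos : 0 < unnormCdf (fun t => Gfun F (s * t)) 1 := by
      simp only [unnormCdf, sub_self, zero_mul, zero_add]
      refine intervalIntegral.intervalIntegral_pos_of_pos_on (hgc.intervalIntegrable _ _)
        (fun t ht => ?_) zero_lt_one
      exact Gfun_pos (hFpos _ (mul_pos hs ht.1)) (hFlt1 _)
    simp only [Icdf_eq_div]
    refine exists_isProbabilityMeasure_Iic_eq ((continuous_unnormCdf hgc).div_const _) ?_ ?_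
      (div_self hpos.ne')
    · intro b hb c hc hbc
      exact div_le_div_of_nonneg_right (monotoneOn_unnormCdf hgc hgm hb hc hbc) hpos.le
    · simp [unnormCdf, hG0]
  · refine Gfun_sub_isLittleO ?_ hFa
    have := hFcont.tendsto 0
    rw [hF0 0 le_rfl] at this
    exact this.mono_left nhdsWithin_le_nhds
end
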